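/- Let R(x,y) = (1−y, x). For every integer K ≥ 3 there exist θ ∈ (0, π/4) and, for each integer N ≥ 0, a point X ∈ [E₁, P₄] with X ≠ E₁ such that (for F = F_θ) F^n(X) ∈ ℬ₁ for 0 ≤ n < K, F^n(X) ∈ 𝒜₁ for K ≤ n < K + N, F^{K+N}(X) = R(X) and F^{4(K+N)}(X) = X, and such that the closed polygonal curve Γ = ⋃_{i=0}^{4(K+N)−1} [F^i(X), F^{i+1}(X)], the union of the line segments joining consecutive points of the orbit of X, is invariant under F: F(Γ) = Γ. -/

import Mathlib

open Real Set Filter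

noncomputable section

/-- A point in the plane. -/
abbrev Pt : Type := ℝ × ℝ

/-- The unit square `Q = [0,1] × [0,1]`. -/
def unitSq : Set Pt := Icc (0:ℝ) 1 ×ˢ Icc (0:ℝ) 1

/-- The corners `E₁, E₂, E₃, E₄` of the unit square (cyclically indexed). -/
def Ept : Fin 4 → Pt := ![(0,0), (1,0), (1,1), (0,1)]

/-- The inner points `P₁, P₂, P₃, P₄` (cyclically indexed). -/
def Ppt (s t : ℝ) : Fin 4 → Pt := ![(s,t), (1-t,s), (1-s,1-t), (t,1-s)]

/-- The image points `P₁′, P₂′, P₃′, P₄′` (cyclically indexed). -/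
def Ppt' (s t : ℝ) : Fin 4 → Pt := ![(1-s,t), (1-t,1-s), (s,1-t), (t,s)]

/-- The triangle `𝒜ᵢ = conv {Eᵢ, Eᵢ₊₁, Pᵢ}`. -/
def Apiece (s t : ℝ) (i : Fin 4) : Set Pt :=
  convexHull ℝ {Ept i, Ept (i+1), Ppt s t i}

/-- The triangle `ℬᵢ = conv {Eᵢ, Pᵢ, Pᵢ₋₁}`. -/
def Bpiece (s t : ℝ) (i : Fin 4) : Set Pt :=
  convexHull ℝ {Ept i, Ppt s t i, Ppt s t (i-1)}

/-- The central square `𝒞 = conv {P₁, P₂, P₃, P₄}`. -/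
def Cpiece (s t : ℝ) : Set Pt :=
  convexHull ℝ {Ppt s t 0, Ppt s t 1, Ppt s t 2, Ppt s t 3}

/-- `F : Q → Q` is continuous, affine on each of the nine pieces, fixes the
corners `Eᵢ` and maps `Pᵢ` to `Pᵢ′`. -/
def IsPAMap (s t : ℝ) (F : Pt → Pt) : Prop :=
  MapsTo F unitSq unitSq ∧
  ContinuousOn F unitSq ∧
  (∀ i : Fin 4, ∃ g : Pt →ᵃ[ℝ] Pt, EqOn F g (Apiece s t i)) ∧
  (∀ i : Fin 4, ∃ g : Pt →ᵃ[ℝ] Pt, EqOn F g (Bpiece s t i)) ∧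
  (∃ g : Pt →ᵃ[ℝ] Pt, EqOn F g (Cpiece s t)) ∧
  (∀ i : Fin 4, F (Ept i) = Ept i) ∧
  (∀ i : Fin 4, F (Ppt s t i) = Ppt' s t i)

/-- `t = sin²θ`. -/
def tof (θ : ℝ) : ℝ := sin θ ^ 2

/-- `s = sinθ·cosθ`. -/
def sof (θ : ℝ) : ℝ := sin θ * cos θ

/-- The rotation by `π/2` about `Z = (1/2, 1/2)`. -/
def Rmap : Pt → Pt := fun p => (1 - p.2, p.1)

/-- The values `sinh (n μ) / sinh μ`, where `τ = 2 cosh μ`. -/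
def chebSeq (τ : ℝ) : ℕ → ℝ
  | 0 => 0
  | 1 => 1
  | n + 2 => τ * chebSeq τ (n + 1) - chebSeq τ n

lemma chebSeq_add_two (τ : ℝ) (n : ℕ) :
    chebSeq τ (n + 2) = τ * chebSeq τ (n + 1) - chebSeq τ n := rfl

lemma chebSeq_nonneg_and_le_succ {τ : ℝ} (hτ : 2 ≤ τ) (n : ℕ) :
    0 ≤ chebSeq τ n ∧ chebSeq τ n ≤ chebSeq τ (n + 1) := by
  induction n with
  | zero => simp [chebSeq]
  | succ n ih =>
    rw [chebSeq_add_two]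
    obtain ⟨h₀, h₁⟩ := ih
    exact ⟨by linarith, by nlinarith⟩

lemma chebSeq_nonneg {τ : ℝ} (hτ : 2 ≤ τ) (n : ℕ) : 0 ≤ chebSeq τ n :=
  (chebSeq_nonneg_and_le_succ hτ n).1

lemma one_le_chebSeq_succ {τ : ℝ} (hτ : 2 ≤ τ) (n : ℕ) : 1 ≤ chebSeq τ (n + 1) := by
  induction n with
  | zero => simp [chebSeq]
  | succ n ih => exact ih.trans (chebSeq_nonneg_and_le_succ hτ (n + 1)).2

lemma chebSeq_sub_mono {τ : ℝ} (hτ : 2 ≤ τ) :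
    Monotone fun n => chebSeq τ (n + 1) - chebSeq τ n := by
  refine monotone_nat_of_le_succ fun n => ?_
  have := chebSeq_nonneg hτ (n + 1)
  simp only [chebSeq_add_two]
  nlinarith

lemma chebSeq_add_le {τ : ℝ} (hτ : 2 ≤ τ) (m n : ℕ) :
    chebSeq τ m + chebSeq τ n ≤ chebSeq τ (m + n) := by
  induction n with
  | zero => simp [chebSeq]
  | succ n ih =>
    have h := chebSeq_sub_mono hτ (Nat.le_add_left n m)
    simp only [← add_assoc] at h ⊢
    linarith

lemma chebSeq_sq_identity (τ : ℝ) (n : ℕ) :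
    chebSeq τ n ^ 2 - τ * chebSeq τ n * chebSeq τ (n + 1) + chebSeq τ (n + 1) ^ 2 = 1 := by
  induction n with
  | zero => simp [chebSeq]
  | succ n ih => rw [chebSeq_add_two]; linear_combination ih

lemma chebSeq_two (n : ℕ) : chebSeq 2 n = n := by
  induction n using Nat.twoStepInduction with
  | zero => simp [chebSeq]
  | one => simp [chebSeq]
  | more n h₀ h₁ => rw [chebSeq_add_two, h₀, h₁]; push_cast; ring

lemma continuousOn_chebSeq {D : Set ℝ} {τ : ℝ → ℝ} (hτ : ContinuousOn τ D) (n : ℕ) :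
    ContinuousOn (fun x => chebSeq (τ x) n) D := by
  induction n using Nat.twoStepInduction with
  | zero => exact continuousOn_const
  | one => exact continuousOn_const
  | more n h₀ h₁ => exact (hτ.mul h₁).sub h₀

lemma mem_convexHull_triple {x y z p : Pt} :
    p ∈ convexHull ℝ {x, y, z} ↔
      ∃ a b c : ℝ, 0 ≤ a ∧ 0 ≤ b ∧ 0 ≤ c ∧ a + b + c = 1 ∧ a • x + b • y + c • z = p := by
  constructor
  · rw [convexHull_insert (by simp), convexHull_pair]
    intro h
    obtain ⟨q, ⟨b, c, hb, hc, hbc, rfl⟩, u, w, hu, hw, huw, rfl⟩ := by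
      simpa only [mem_convexJoin, mem_singleton_iff, exists_eq_left] using h
    refine ⟨u, w * b, w * c, hu, by positivity, by positivity, ?_, ?_⟩
    · linear_combination huw + w * hbc
    · module
  · rintro ⟨a, b, c, ha, hb, hc, h, rfl⟩
    have hmem (q : Pt) (hq : q ∈ ({x, y, z} : Set Pt)) : q ∈ convexHull ℝ {x, y, z} :=
      subset_convexHull ℝ _ hq
    have := (convex_convexHull ℝ {x, y, z}).sum_mem (t := Finset.univ) (w := ![a, b, c])
      (z := ![x, y, z]) (by simp [Fin.forall_fin_succ, ha, hb, hc])
      (by simp [Fin.sum_univ_succ, ← h, add_assoc])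
      (by intro i _; fin_cases i <;> exact hmem _ (by simp))
    simpa [Fin.sum_univ_succ, add_assoc] using this

lemma AffineMap.map_triple (g : Pt →ᵃ[ℝ] Pt) (x y z : Pt) {a b c : ℝ} (h : a + b + c = 1) :
    g (a • x + b • y + c • z) = a • g x + b • g y + c • g z := by
  have hg (p : Pt) : g p = g.linear p + g 0 := congrFun g.decomp p
  rw [hg, hg x, hg y, hg z]
  simp only [map_add, map_smul]
  have : g 0 = (a + b + c) • g 0 := by rw [h, one_smul]
  nth_rw 1 [this]
  module

lemma apply_triple {F : Pt → Pt} {x y z : Pt}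
    (hF : ∃ g : Pt →ᵃ[ℝ] Pt, EqOn F g (convexHull ℝ {x, y, z}))
    {a b c : ℝ} (ha : 0 ≤ a) (hb : 0 ≤ b) (hc : 0 ≤ c) (h : a + b + c = 1) :
    F (a • x + b • y + c • z) = a • F x + b • F y + c • F z := by
  obtain ⟨g, hg⟩ := hF
  rw [hg (mem_convexHull_triple.2 ⟨a, b, c, ha, hb, hc, h, rfl⟩), g.map_triple x y z h,
    hg (subset_convexHull ℝ _ (by simp)), hg (subset_convexHull ℝ _ (by simp)),
    hg (subset_convexHull ℝ _ (by simp))]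

lemma image_segment_of_eqOn {F : Pt → Pt} {D : Set Pt} (hD : Convex ℝ D)
    (hF : ∃ g : Pt →ᵃ[ℝ] Pt, EqOn F g D) {p q : Pt} (hp : p ∈ D) (hq : q ∈ D) :
    F '' segment ℝ p q = segment ℝ (F p) (F q) := by
  obtain ⟨g, hg⟩ := hF
  rw [(hg.mono (hD.segment_subset hp hq)).image_eq, image_segment, hg hp, hg hq]

lemma Rmap_triple (x y z : Pt) {a b c : ℝ} (h : a + b + c = 1) :
    Rmap (a • x + b • y + c • z) = a • Rmap x + b • Rmap y + c • Rmap z := by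
  ext
  · simp [Rmap]; linear_combination -h
  · simp [Rmap]

lemma Rmap_mem_and_comm {F : Pt → Pt} {x y z x' y' z' : Pt}
    (hF : ∃ g : Pt →ᵃ[ℝ] Pt, EqOn F g (convexHull ℝ {x, y, z}))
    (hF' : ∃ g : Pt →ᵃ[ℝ] Pt, EqOn F g (convexHull ℝ {x', y', z'}))
    (hx : Rmap x = x') (hy : Rmap y = y') (hz : Rmap z = z')
    (hFx : Rmap (F x) = F x') (hFy : Rmap (F y) = F y') (hFz : Rmap (F z) = F z')
    {p : Pt} (hp : p ∈ convexHull ℝ {x, y, z}) :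
    Rmap p ∈ convexHull ℝ {x', y', z'} ∧ F (Rmap p) = Rmap (F p) := by
  obtain ⟨a, b, c, ha, hb, hc, h, rfl⟩ := mem_convexHull_triple.1 hp
  rw [apply_triple hF ha hb hc h, Rmap_triple _ _ _ h, Rmap_triple _ _ _ h, hx, hy, hz,
    hFx, hFy, hFz, apply_triple hF' ha hb hc h]
  exact ⟨mem_convexHull_triple.2 ⟨a, b, c, ha, hb, hc, h, rfl⟩, rfl⟩

lemma Rmap_Ept (i : Fin 4) : Rmap (Ept i) = Ept (i + 1) := by
  fin_cases i <;> simp [Rmap, Ept]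

lemma Rmap_Ppt (s t : ℝ) (i : Fin 4) : Rmap (Ppt s t i) = Ppt s t (i + 1) := by
  fin_cases i <;> simp [Rmap, Ppt]

lemma Rmap_Ppt' (s t : ℝ) (i : Fin 4) : Rmap (Ppt' s t i) = Ppt' s t (i + 1) := by
  fin_cases i <;> simp [Rmap, Ppt']

lemma Rmap_iterate_four (p : Pt) : Rmap^[4] p = p := by
  ext <;> simp [Rmap]

namespace IsPAMap

variable {s t : ℝ} {F : Pt → Pt}

lemma Rmap_Apiece (hF : IsPAMap s t F) (i : Fin 4) {p : Pt} (hp : p ∈ Apiece s t i) :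
    Rmap p ∈ Apiece s t (i + 1) ∧ F (Rmap p) = Rmap (F p) := by
  obtain ⟨-, -, hA, -, -, hE, hP⟩ := hF
  exact Rmap_mem_and_comm (hA i) (hA (i + 1)) (Rmap_Ept _) (Rmap_Ept _) (Rmap_Ppt _ _ _)
    (by rw [hE, hE, Rmap_Ept]) (by rw [hE, hE, Rmap_Ept]) (by rw [hP, hP, Rmap_Ppt']) hp

lemma Rmap_Bpiece (hF : IsPAMap s t F) (i : Fin 4) {p : Pt} (hp : p ∈ Bpiece s t i) :
    Rmap p ∈ Bpiece s t (i + 1) ∧ F (Rmap p) = Rmap (F p) := by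
  obtain ⟨-, -, -, hB, -, hE, hP⟩ := hF
  have hi : i - 1 + 1 = i + 1 - 1 := by abel
  exact Rmap_mem_and_comm (hB i) (hB (i + 1)) (Rmap_Ept _) (Rmap_Ppt _ _ _)
    (by rw [Rmap_Ppt, hi]) (by rw [hE, hE, Rmap_Ept])
    (by rw [hP, hP, Rmap_Ppt']) (by rw [hP, hP, Rmap_Ppt', hi]) hp

end IsPAMap

/-- A family of convex sets, permuted by `Rmap`, on each of which `F` is affine and
commutes with `Rmap`. -/
structure IsEquivariantFamily (F : Pt → Pt) (D : Fin 4 → Set Pt) : Prop where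
  convex : ∀ i, Convex ℝ (D i)
  affine : ∀ i, ∃ g : Pt →ᵃ[ℝ] Pt, EqOn F g (D i)
  equivariant : ∀ i, ∀ p ∈ D i, Rmap p ∈ D (i + 1) ∧ F (Rmap p) = Rmap (F p)

lemma IsPAMap.isEquivariantFamily_Apiece {s t : ℝ} {F : Pt → Pt} (hF : IsPAMap s t F) :
    IsEquivariantFamily F (Apiece s t) :=
  ⟨fun _ => convex_convexHull ℝ _, hF.2.2.1, fun i _ hp => hF.Rmap_Apiece i hp⟩

lemma IsPAMap.isEquivariantFamily_Bpiece {s t : ℝ} {F : Pt → Pt} (hF : IsPAMap s t F) :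
    IsEquivariantFamily F (Bpiece s t) :=
  ⟨fun _ => convex_convexHull ℝ _, hF.2.2.2.1, fun i _ hp => hF.Rmap_Bpiece i hp⟩

namespace IsEquivariantFamily

variable {F : Pt → Pt} {D : Fin 4 → Set Pt}

lemma iterate_Rmap (hD : IsEquivariantFamily F D) {p : Pt} (hp : p ∈ D 0) (q : ℕ) :
    Rmap^[q] p ∈ D (Fin.ofNat 4 q) ∧ F (Rmap^[q] p) = Rmap^[q] (F p) := by
  induction q with
  | zero => exact ⟨hp, rfl⟩
  | succ q ih =>
    obtain ⟨h₀, h₁⟩ := ih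
    obtain ⟨h₂, h₃⟩ := hD.equivariant _ _ h₀
    have hq : Fin.ofNat 4 (q + 1) = Fin.ofNat 4 q + 1 := by
      ext; simp [Fin.val_add]
    rw [Function.iterate_succ_apply', Function.iterate_succ_apply', hq, h₃, h₁]
    exact ⟨h₂, rfl⟩

lemma image_segment_iterate_Rmap (hD : IsEquivariantFamily F D) {p p' : Pt}
    (hp : p ∈ D 0) (hp' : p' ∈ D 0) (q : ℕ) :
    F '' segment ℝ (Rmap^[q] p) (Rmap^[q] p') =
      segment ℝ (F (Rmap^[q] p)) (F (Rmap^[q] p')) :=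
  image_segment_of_eqOn (hD.convex _) (hD.affine _) (hD.iterate_Rmap hp q).1
    (hD.iterate_Rmap hp' q).1

end IsEquivariantFamily

lemma image_biUnion_eq_of_periodic {α : Type*} {F : α → α} {S : ℕ → Set α} {n : ℕ} (hn : 0 < n)
    (hS : ∀ i, F '' S i = S (i + 1)) (hper : S n = S 0) :
    F '' (⋃ i ∈ Finset.range n, S i) = ⋃ i ∈ Finset.range n, S i := by
  simp only [image_iUnion, hS]
  obtain ⟨k, rfl⟩ : ∃ k, n = k + 1 := ⟨n - 1, by omega⟩
  ext p
  simp only [mem_iUnion, Finset.mem_range, exists_prop]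
  constructor
  · rintro ⟨i, hi, hp⟩
    obtain h | rfl : i < k ∨ i = k := by omega
    · exact ⟨i + 1, by omega, hp⟩
    · exact ⟨0, by omega, hper ▸ hp⟩
  · rintro ⟨i, hi, hp⟩
    cases i with
    | zero => exact ⟨k, by omega, hper ▸ hp⟩
    | succ i => exact ⟨i, by omega, hp⟩

lemma periodic_and_invariant_of_quarter {F : Pt → Pt} {X : Pt} {m : ℕ} (hm : 0 < m)
    (hD : ∀ n < m, ∃ D, IsEquivariantFamily F D ∧ F^[n] X ∈ D 0 ∧ F^[n + 1] X ∈ D 0)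
    (hR : F^[m] X = Rmap X) :
    F^[4 * m] X = X ∧
      F '' (⋃ i ∈ Finset.range (4 * m), segment ℝ (F^[i] X) (F^[i+1] X))
        = ⋃ i ∈ Finset.range (4 * m), segment ℝ (F^[i] X) (F^[i+1] X) := by
  have hcomm (q n : ℕ) (hn : n ≤ m) : F^[n] (Rmap^[q] X) = Rmap^[q] (F^[n] X) := by
    induction n with
    | zero => rfl
    | succ n ih =>
      obtain ⟨D, hF, h, -⟩ := hD n hn
      rw [Function.iterate_succ_apply', ih (by omega), (hF.iterate_Rmap h q).2,
        Function.iterate_succ_apply' F]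
  have hquarter (q : ℕ) : F^[m * q] X = Rmap^[q] X := by
    induction q with
    | zero => rfl
    | succ q ih =>
      rw [Nat.mul_succ, add_comm, Function.iterate_add_apply, ih, hcomm q m le_rfl, hR,
        ← Function.iterate_succ_apply]
  have hdecomp (q r : ℕ) (hr : r ≤ m) : F^[m * q + r] X = Rmap^[q] (F^[r] X) := by
    rw [add_comm, Function.iterate_add_apply, hquarter, hcomm q r hr]
  have hper : F^[4 * m] X = X := by rw [mul_comm, hquarter, Rmap_iterate_four]
  refine ⟨hper, image_biUnion_eq_of_periodic (S := fun i => segment ℝ (F^[i] X) (F^[i+1] X))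
    (by omega) (fun i => ?_) ?_⟩
  · have hr := Nat.mod_lt i hm
    obtain ⟨D, hF, h₀, h₁⟩ := hD _ hr
    have e₀ := hdecomp (i / m) _ hr.le
    have e₁ := hdecomp (i / m) _ hr
    rw [Nat.succ_eq_add_one, ← add_assoc, Nat.div_add_mod] at e₁
    rw [Nat.div_add_mod] at e₀
    simp only [Function.iterate_succ_apply' F (i + 1)]
    rw [e₀, e₁, hF.image_segment_iterate_Rmap h₀ h₁, ← e₀, ← e₁, ← Function.iterate_succ_apply' F]
  · simp only [Function.iterate_succ_apply', hper, Function.iterate_zero, id]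

/-- The point with coordinates `a, b` in the basis `P₁, P₄`. -/
def wedgePt (s t a b : ℝ) : Pt := a • Ppt s t 0 + b • Ppt s t 3

lemma wedgePt_eq (s t a b : ℝ) :
    wedgePt s t a b = (1 - a - b) • Ept 0 + a • Ppt s t 0 + b • Ppt s t 3 := by
  simp [wedgePt, Ept, show ((0 : ℝ), (0 : ℝ)) = 0 from rfl]

lemma wedgePt_mem {s t a b : ℝ} (ha : 0 ≤ a) (hb : 0 ≤ b) (hab : a + b ≤ 1) :
    wedgePt s t a b ∈ Bpiece s t 0 := by
  rw [wedgePt_eq]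
  exact mem_convexHull_triple.2 ⟨_, _, _, by linarith, ha, hb, by ring, rfl⟩

lemma chebSeq_reflect {τ u v : ℝ} {K : ℕ} (huv : u ^ 2 = v ^ 2 - τ * v + 1)
    (hv : v * chebSeq τ (K + 1) = chebSeq τ K) (hu : u * chebSeq τ (K + 1) = 1) (j n : ℕ)
    (hn : n + j = K) : v * chebSeq τ (n + 1) - chebSeq τ n = u * chebSeq τ j := by
  induction j using Nat.twoStepInduction generalizing n with
  | zero => subst hn; simpa [chebSeq, sub_eq_zero] using hv
  | one =>
    subst hn
    rw [chebSeq_add_two] at hv hu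
    simp only [chebSeq]
    linear_combination (τ - v) * hv - (τ * chebSeq τ (n + 1) - chebSeq τ n) * huv + u * hu
  | more j h₀ h₁ =>
    have h₀ := h₀ (n + 2) (by omega)
    have h₁ := h₁ (n + 1) (by omega)
    simp only [chebSeq_add_two] at h₀ h₁ ⊢
    linear_combination τ * h₁ - h₀

section Orbit

variable {s t τ : ℝ} {F : Pt → Pt}

lemma IsPAMap.apply_wedgePt (hF : IsPAMap s t F) (hst : s ^ 2 = t - t ^ 2) (hv : 0 < s + t)
    (hτ : τ * (s + t) = 1 + 4 * s * t) {a b : ℝ} (ha : 0 ≤ a) (hb : 0 ≤ b) (hab : a + b ≤ 1) :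
    F (wedgePt s t a b) =
      wedgePt s t ((τ - (s + t)) * a + (s - t) * b) ((s + t) * b - (s - t) * a) := by
  have happ := apply_triple (hF.2.2.2.1 0) (by linarith : 0 ≤ 1 - a - b) ha hb (by ring)
  rw [show (0 : Fin 4) - 1 = 3 from rfl] at happ
  rw [wedgePt_eq, happ]
  obtain ⟨-, -, -, -, -, hE, hP⟩ := hF
  have hx : (τ - (s + t)) * s - (s - t) * t = 1 - s := by
    apply mul_left_cancel₀ hv.ne'
    linear_combination s * hτ + (1 - s + t) * hst
  have hy : (τ - (s + t)) * t - (s - t) * (1 - s) = t := by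
    apply mul_left_cancel₀ hv.ne'
    linear_combination t * hτ - (1 - s + t) * hst
  rw [hE, hP, hP]
  ext
  · simp [wedgePt, Ept, Ppt, Ppt']
    linear_combination -a * hx - b * hst
  · simp [wedgePt, Ept, Ppt, Ppt']
    linear_combination -a * hy + b * hst

lemma IsPAMap.iterate_wedgePt (hF : IsPAMap s t F) (hst : s ^ 2 = t - t ^ 2) (hv : 0 < s + t)
    (hts : t ≤ s) (hτ2 : 2 ≤ τ) (hτ : τ * (s + t) = 1 + 4 * s * t) {K : ℕ}
    (hK : (s + t) * chebSeq τ (K + 1) = chebSeq τ K) (hu : (s - t) * chebSeq τ (K + 1) = 1)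
    {α : ℝ} (hα : 0 ≤ α) (hα1 : α ≤ 1) (n j : ℕ) (hn : n + j = K + 1) :
    F^[n] (wedgePt s t 0 α) =
        wedgePt s t (α * ((s - t) * chebSeq τ n)) (α * ((s - t) * chebSeq τ j)) ∧
      wedgePt s t (α * ((s - t) * chebSeq τ n)) (α * ((s - t) * chebSeq τ j)) ∈
        Bpiece s t 0 := by
  have hrefl := chebSeq_reflect (τ := τ) (u := s - t) (v := s + t) (by linear_combination hτ) hK hu
  have hst0 : 0 ≤ s - t := by linarith
  have hnn (n : ℕ) : 0 ≤ α * ((s - t) * chebSeq τ n) :=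
    mul_nonneg hα (mul_nonneg hst0 (chebSeq_nonneg hτ2 n))
  have hle (n j : ℕ) (hn : n + j = K + 1) :
      α * ((s - t) * chebSeq τ n) + α * ((s - t) * chebSeq τ j) ≤ 1 := by
    have h := mul_le_mul_of_nonneg_left (chebSeq_add_le hτ2 n j) hst0
    rw [hn, hu] at h
    nlinarith
  refine ⟨?_, wedgePt_mem (hnn n) (hnn j) (hle n j hn)⟩
  induction n generalizing j with
  | zero =>
    obtain rfl : j = K + 1 := by omega
    simp [hu, chebSeq]
  | succ n ih =>
    rw [Function.iterate_succ_apply', ih (j + 1) (by omega),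
      hF.apply_wedgePt hst hv hτ (hnn _) (hnn _) (hle _ _ (by omega))]
    congr 1
    · cases n with
      | zero =>
        obtain rfl : j = K := by omega
        simp only [chebSeq]
        linear_combination α * (s - t) * hu
      | succ n =>
        rw [chebSeq_add_two]
        linear_combination -α * (s - t) * hrefl (j + 1) n (by omega)
    · linear_combination α * (s - t) * hrefl n j (by omega)

/-- The point with coordinates `b, α` in the basis `E₂, P₁`. -/
def shearPt (s t b α : ℝ) : Pt := b • Ept 1 + α • Ppt s t 0

lemma shearPt_eq (s t b α : ℝ) :
    shearPt s t b α = (1 - b - α) • Ept 0 + b • Ept (0 + 1) + α • Ppt s t 0 := by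
  simp [shearPt, Ept, show ((0 : ℝ), (0 : ℝ)) = 0 from rfl]

lemma shearPt_mem {b α : ℝ} (hb : 0 ≤ b) (hα : 0 ≤ α) (h : b + α ≤ 1) :
    shearPt s t b α ∈ Apiece s t 0 := by
  rw [shearPt_eq]
  exact mem_convexHull_triple.2 ⟨_, _, _, by linarith, hb, hα, by ring, rfl⟩

lemma IsPAMap.apply_shearPt (hF : IsPAMap s t F) {b α : ℝ} (hb : 0 ≤ b) (hα : 0 ≤ α)
    (h : b + α ≤ 1) : F (shearPt s t b α) = shearPt s t (b + α * (1 - 2 * s)) α := by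
  rw [shearPt_eq, apply_triple (hF.2.2.1 0) (by linarith) hb hα (by ring)]
  obtain ⟨-, -, -, -, -, hE, hP⟩ := hF
  rw [hE, hE, hP]
  ext
  · simp [shearPt, Ept, Ppt, Ppt']; ring
  · simp [shearPt, Ept, Ppt, Ppt']

lemma IsPAMap.iterate_shearPt (hF : IsPAMap s t F) (hs : s ≤ 1 / 2) {α : ℝ} (hα : 0 ≤ α)
    {N : ℕ} (hαN : α * (1 + N * (1 - 2 * s)) = 1) (j : ℕ) (hj : j ≤ N) :
    F^[j] (shearPt s t 0 α) = shearPt s t (j * (α * (1 - 2 * s))) α ∧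
      shearPt s t (j * (α * (1 - 2 * s))) α ∈ Apiece s t 0 := by
  have hd : 0 ≤ α * (1 - 2 * s) := mul_nonneg hα (by linarith)
  have hle (j : ℕ) (hj : j ≤ N) : j * (α * (1 - 2 * s)) + α ≤ 1 := by
    have : (j : ℝ) * (α * (1 - 2 * s)) ≤ N * (α * (1 - 2 * s)) := by gcongr
    linarith
  refine ⟨?_, shearPt_mem (by positivity) hα (hle j hj)⟩
  induction j with
  | zero => simp
  | succ j ih =>
    rw [Function.iterate_succ_apply', ih (by omega),
      hF.apply_shearPt (by positivity) hα (hle j (by omega))]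
    congr 1
    push_cast
    ring

lemma IsPAMap.exists_invariant_polygon (hF : IsPAMap s t F) (hst : s ^ 2 = t - t ^ 2)
    (ht : 0 < t) (hts : t ≤ s) (hs : s ≤ 1 / 2) (hτ2 : 2 ≤ τ)
    (hτ : τ * (s + t) = 1 + 4 * s * t) {K : ℕ}
    (hK : (s + t) * chebSeq τ (K + 1) = chebSeq τ K) (N : ℕ) :
    ∃ X ∈ segment ℝ (Ept 0) (Ppt s t 3),
      X ≠ Ept 0 ∧
      (∀ n < K + 1, F^[n] X ∈ Bpiece s t 0) ∧
      (∀ n, K + 1 ≤ n → n < K + 1 + N → F^[n] X ∈ Apiece s t 0) ∧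
      F^[K + 1 + N] X = Rmap X ∧
      F^[4*(K + 1 + N)] X = X ∧
      F '' (⋃ i ∈ Finset.range (4*(K + 1 + N)), segment ℝ (F^[i] X) (F^[i+1] X))
        = ⋃ i ∈ Finset.range (4*(K + 1 + N)), segment ℝ (F^[i] X) (F^[i+1] X) := by
  have hv : 0 < s + t := by linarith
  have hu : (s - t) * chebSeq τ (K + 1) = 1 := by
    have h0 : 0 ≤ (s - t) * chebSeq τ (K + 1) :=
      mul_nonneg (by linarith) (chebSeq_nonneg hτ2 _)
    have hsq : ((s - t) * chebSeq τ (K + 1)) ^ 2 = 1 := by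
      have h := chebSeq_sq_identity τ K
      rw [← hK] at h
      linear_combination h + chebSeq τ (K + 1) ^ 2 * hτ
    nlinarith
  have hden : 0 < 1 + N * (1 - 2 * s) := by
    have : 0 ≤ N * (1 - 2 * s) := mul_nonneg N.cast_nonneg (by linarith)
    linarith
  obtain ⟨α, hα⟩ : ∃ α : ℝ, α * (1 + N * (1 - 2 * s)) = 1 :=
    ⟨_, inv_mul_cancel₀ hden.ne'⟩
  have hα0 : 0 < α := pos_of_mul_pos_left (by rw [hα]; exact one_pos) hden.le
  have hα1 : α ≤ 1 := by
    have : 0 ≤ α * (N * (1 - 2 * s)) :=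
      mul_nonneg hα0.le (mul_nonneg N.cast_nonneg (by linarith))
    linarith
  have hwedge := hF.iterate_wedgePt hst hv hts hτ2 hτ hK hu hα0.le hα1
  have hshear := hF.iterate_shearPt hs hα0.le hα
  set X := wedgePt s t 0 α with hX
  have hB (n : ℕ) (hn : n ≤ K + 1) : F^[n] X ∈ Bpiece s t 0 := by
    obtain ⟨h, h'⟩ := hwedge n (K + 1 - n) (by omega)
    rwa [h]
  have hlast : F^[K + 1] X = shearPt s t 0 α := by
    rw [(hwedge (K + 1) 0 rfl).1, hu]
    simp [wedgePt, shearPt, chebSeq]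
  have hA (j : ℕ) (hj : j ≤ N) :
      F^[K + 1 + j] X = shearPt s t (j * (α * (1 - 2 * s))) α ∧
        F^[K + 1 + j] X ∈ Apiece s t 0 := by
    obtain ⟨h, h'⟩ := hshear j hj
    rw [add_comm, Function.iterate_add_apply, hlast, h]
    exact ⟨rfl, h'⟩
  have hR : F^[K + 1 + N] X = Rmap X := by
    rw [(hA N le_rfl).1, hX]
    ext
    · simp [shearPt, wedgePt, Rmap, Ept, Ppt]
      linear_combination hα
    · simp [shearPt, wedgePt, Rmap, Ept, Ppt]
  refine ⟨X, ⟨1 - α, α, by linarith, hα0.le, by ring, ?_⟩, ?_, fun n hn => hB n hn.le,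
    fun n hn hnN => ?_, hR, periodic_and_invariant_of_quarter (by omega) (fun n hn => ?_) hR⟩
  · simp [hX, wedgePt, Ept]
  · intro h
    have := congrArg Prod.fst h
    simp [hX, wedgePt, Ept, Ppt, hα0.ne', ht.ne'] at this
  · obtain ⟨j, rfl⟩ := Nat.exists_eq_add_of_le hn
    exact (hA j (by omega)).2
  · by_cases h : n < K + 1
    · exact ⟨_, hF.isEquivariantFamily_Bpiece, hB n h.le, hB (n + 1) h⟩
    · obtain ⟨j, rfl⟩ := Nat.exists_eq_add_of_le (not_lt.1 h)
      exact ⟨_, hF.isEquivariantFamily_Apiece, (hA j (by omega)).2, (hA (j + 1) (by omega)).2⟩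

end Orbit

lemma sof_eq (θ : ℝ) : sof θ = sin (2 * θ) / 2 := by
  rw [sof, sin_two_mul]; ring

lemma tof_eq (θ : ℝ) : tof θ = (1 - cos (2 * θ)) / 2 := by
  rw [tof, sin_sq_eq_half_sub]; ring

lemma sof_sq (θ : ℝ) : sof θ ^ 2 = tof θ - tof θ ^ 2 := by
  rw [sof, tof]
  linear_combination sin θ ^ 2 * sin_sq_add_cos_sq θ

lemma sof_le_half (θ : ℝ) : sof θ ≤ 1 / 2 := by
  rw [sof_eq]; linarith [sin_le_one (2 * θ)]

lemma tof_pos {θ : ℝ} (h₀ : 0 < θ) (h₁ : θ ≤ π / 4) : 0 < tof θ :=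
  pow_pos (sin_pos_of_pos_of_lt_pi h₀ (by linarith [pi_pos])) 2

lemma tof_le_half {θ : ℝ} (h₀ : 0 < θ) (h₁ : θ ≤ π / 4) : tof θ ≤ 1 / 2 := by
  have := cos_nonneg_of_mem_Icc (x := 2 * θ) ⟨by linarith [pi_pos], by linarith⟩
  rw [tof_eq]; linarith

lemma tof_le_sof {θ : ℝ} (h₀ : 0 < θ) (h₁ : θ ≤ π / 4) : tof θ ≤ sof θ := by
  have hs : 0 ≤ sof θ := by
    rw [sof_eq]
    linarith [sin_nonneg_of_nonneg_of_le_pi (x := 2 * θ) (by linarith) (by linarith [pi_pos])]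
  have := tof_pos h₀ h₁
  have := tof_le_half h₀ h₁
  nlinarith [sof_sq θ]

/-- The trace of the linear part of `F` on `ℬ₁`. -/
def traceB (θ : ℝ) : ℝ := (1 + 4 * sof θ * tof θ) / (sof θ + tof θ)

lemma sof_add_tof_pos {θ : ℝ} (h₀ : 0 < θ) (h₁ : θ ≤ π / 4) : 0 < sof θ + tof θ := by
  linarith [tof_pos h₀ h₁, tof_le_sof h₀ h₁]

lemma traceB_mul {θ : ℝ} (h₀ : 0 < θ) (h₁ : θ ≤ π / 4) :
    traceB θ * (sof θ + tof θ) = 1 + 4 * sof θ * tof θ :=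
  div_mul_cancel₀ _ (sof_add_tof_pos h₀ h₁).ne'

lemma two_le_traceB {θ : ℝ} (h₀ : 0 < θ) (h₁ : θ ≤ π / 4) : 2 ≤ traceB θ := by
  rw [traceB, le_div_iff₀ (sof_add_tof_pos h₀ h₁)]
  nlinarith [mul_nonneg (sub_nonneg.2 (sof_le_half θ)) (sub_nonneg.2 (tof_le_half h₀ h₁))]

lemma exists_angle_chebSeq (k : ℕ) :
    ∃ θ ∈ Ioo 0 (π / 4),
      (sof θ + tof θ) * chebSeq (traceB θ) (k + 3) = chebSeq (traceB θ) (k + 2) := by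
  have hπ := pi_pos
  let f : ℝ → ℝ := fun θ =>
    (sof θ + tof θ) * chebSeq (traceB θ) (k + 3) - chebSeq (traceB θ) (k + 2)
  have hsof : Continuous sof := continuous_sin.mul continuous_cos
  have htof : Continuous tof := continuous_sin.pow 2
  have htrace : ContinuousOn traceB (Icc (π / 12) (π / 4)) :=
    ContinuousOn.div (by fun_prop) (by fun_prop)
      fun θ hθ => (sof_add_tof_pos (by linarith [hθ.1]) hθ.2).ne'
  have hf : ContinuousOn f (Icc (π / 12) (π / 4)) :=
    ((hsof.add htof).continuousOn.mul (continuousOn_chebSeq htrace _)).sub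
      (continuousOn_chebSeq htrace _)
  have hneg : f (π / 12) < 0 := by
    have h₀ : 0 < π / 12 := by linarith
    have h₁ : π / 12 ≤ π / 4 := by linarith
    have hs : sof (π / 12) = 1 / 4 := by
      rw [sof_eq, show 2 * (π / 12) = π / 6 by ring, sin_pi_div_six]; norm_num
    have ht : tof (π / 12) < 1 / 2 := by
      rw [tof_eq]
      linarith [cos_pos_of_mem_Ioo (x := 2 * (π / 12)) ⟨by linarith, by linarith⟩]
    have ht0 := tof_pos h₀ h₁
    have hτ := traceB_mul h₀ h₁
    have hτ2 := two_le_traceB h₀ h₁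
    have hsq := sof_sq (π / 12)
    have hS := chebSeq_nonneg hτ2 k
    have hS1 := one_le_chebSeq_succ hτ2 k
    simp only [f]
    rw [chebSeq_add_two _ (k + 1), chebSeq_add_two]
    rw [hs] at hτ hsq ⊢
    generalize traceB (π / 12) = τ at *
    generalize tof (π / 12) = t at *
    have hcoef : t * τ < 1 / 4 + t := by nlinarith
    have key : (1 / 4 + t) * (τ * (τ * chebSeq τ (k + 1) - chebSeq τ k) - chebSeq τ (k + 1)) -
        (τ * chebSeq τ (k + 1) - chebSeq τ k) =
        (t * τ - (1 / 4 + t)) * chebSeq τ (k + 1) - t * chebSeq τ k := by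
      linear_combination (τ * chebSeq τ (k + 1) - chebSeq τ k) * hτ
    rw [key]
    nlinarith [mul_nonneg ht0.le hS]
  have hpos : 0 < f (π / 4) := by
    have hs : sof (π / 4) = 1 / 2 := by
      rw [sof_eq, show 2 * (π / 4) = π / 2 by ring, sin_pi_div_two]
    have ht : tof (π / 4) = 1 / 2 := by
      rw [tof_eq, show 2 * (π / 4) = π / 2 by ring, cos_pi_div_two]; norm_num
    have hτ : traceB (π / 4) = 2 := by rw [traceB, hs, ht]; norm_num
    simp only [f, hs, ht, hτ, chebSeq_two]
    push_cast
    linarith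
  obtain ⟨θ, hθ, h⟩ := intermediate_value_Ioo (by linarith) hf ⟨hneg, hpos⟩
  exact ⟨θ, ⟨by linarith [hθ.1], hθ.2⟩, sub_eq_zero.1 h⟩

/-- For every integer `K ≥ 3` there are `θ ∈ (0, π/4)` and, for
each `N ≥ 0`, a point `X ∈ [E₁,P₄]`, `X ≠ E₁`, with `Fⁿ(X) ∈ ℬ₁` for `0 ≤ n < K`,
`Fⁿ(X) ∈ 𝒜₁` for `K ≤ n < K+N`, `F^{K+N}(X) = R(X)`, `F^{4(K+N)}(X) = X`, and the
closed polygonal curve `Γ` joining consecutive orbit points of `X` is `F`-invariant: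
`F(Γ) = Γ`. -/
theorem exists_invariant_circle (K : ℕ) (hK : 3 ≤ K) :
    ∃ θ ∈ Ioo 0 (π/4), ∀ F : Pt → Pt, IsPAMap (sof θ) (tof θ) F →
      ∀ N : ℕ, ∃ X ∈ segment ℝ (Ept 0) (Ppt (sof θ) (tof θ) 3),
        X ≠ Ept 0 ∧
        (∀ n < K, F^[n] X ∈ Bpiece (sof θ) (tof θ) 0) ∧
        (∀ n, K ≤ n → n < K + N → F^[n] X ∈ Apiece (sof θ) (tof θ) 0) ∧
        F^[K + N] X = Rmap X ∧
        F^[4*(K + N)] X = X ∧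
        F '' (⋃ i ∈ Finset.range (4*(K + N)), segment ℝ (F^[i] X) (F^[i+1] X))
          = ⋃ i ∈ Finset.range (4*(K + N)), segment ℝ (F^[i] X) (F^[i+1] X) := by
  obtain ⟨k, rfl⟩ := Nat.exists_eq_add_of_le' hK
  obtain ⟨θ, hθ, h⟩ := exists_angle_chebSeq k
  exact ⟨θ, hθ, fun F hF N => hF.exists_invariant_polygon (sof_sq θ) (tof_pos hθ.1 hθ.2.le)
    (tof_le_sof hθ.1 hθ.2.le) (sof_le_half θ) (two_le_traceB hθ.1 hθ.2.le)
    (traceB_mul hθ.1 hθ.2.le) h N⟩
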